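/- There exists a constant c > 0 such that every finite simple graph G with chromatic number χ(G) ≥ 2 satisfies η(G) ≥ c · χ(G) / √(log χ(G)). -/

import Mathlib

open SimpleGraph

/-- `H` is a minor of `G`: there is a family of branch sets in `G`, one for each vertex of `H`,
which are pairwise disjoint, each inducing a connected subgraph of `G`, such that every edge of
`H` is witnessed by an edge of `G` between the corresponding branch sets. -/
def SimpleGraph.IsMinorOf {W V : Type*} (H : SimpleGraph W) (G : SimpleGraph V) : Prop :=
  ∃ f : W → Set V,
    (∀ w, (G.induce (f w)).Connected) ∧
    (Pairwise fun w w' => Disjoint (f w) (f w')) ∧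
    ∀ ⦃w w'⦄, H.Adj w w' → ∃ u ∈ f w, ∃ v ∈ f w', G.Adj u v

/-- The Hadwiger number of `G`: the largest `n` such that `K_n` is a minor of `G`. -/
noncomputable def SimpleGraph.hadwigerNumber {V : Type*} (G : SimpleGraph V) : ℕ :=
  sSup {n : ℕ | (⊤ : SimpleGraph (Fin n)).IsMinorOf G}

namespace HadwigerBound

open Finset

section

open scoped Classical

/-- A family `f` of branch sets in `G` realising, as a minor, the subgraph of `H` induced on the
finite set `S`. -/
structure IsModelOn {W V : Type*} (H : SimpleGraph W) (G : SimpleGraph V) (S : Finset W)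
    (f : W → Set V) : Prop where
  connected : ∀ v ∈ S, (G.induce (f v)).Connected
  disjoint : ∀ v ∈ S, ∀ w ∈ S, v ≠ w → Disjoint (f v) (f w)
  adj : ∀ v ∈ S, ∀ w ∈ S, H.Adj v w → ∃ a ∈ f v, ∃ b ∈ f w, G.Adj a b

lemma colorable_of_forall_exists_lt {V : Type*} [Fintype V] (G : SimpleGraph V) (m : ℕ)
    (h : ∀ S : Finset V, S.Nonempty → ∃ x ∈ S, #{y ∈ S | G.Adj x y} < m) : G.Colorable m := by
  have key : ∀ n : ℕ, ∀ S : Finset V, #S = n → ∃ c : V → ℕ, (∀ x ∈ S, c x < m) ∧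
      ∀ x ∈ S, ∀ y ∈ S, G.Adj x y → c x ≠ c y := by
    intro n
    induction n with
    | zero =>
      intro S hS
      rw [card_eq_zero] at hS
      subst hS
      exact ⟨fun _ => 0, by simp, by simp⟩
    | succ n ih =>
      intro S hS
      obtain ⟨x, hx, hlt⟩ := h S (card_pos.mp (by omega))
      obtain ⟨c, hc, hp⟩ := ih (S.erase x) (by rw [card_erase_of_mem hx]; omega)
      have : ∃ i ∈ range m, i ∉ image c {y ∈ S | G.Adj x y} := by
        apply exists_mem_notMem_of_card_lt_card
        rw [card_range]
        exact card_image_le.trans_lt hlt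
      obtain ⟨i, hi, hni⟩ := this
      simp only [mem_image, mem_filter, not_exists, not_and, and_imp] at hni
      refine ⟨Function.update c x i, ?_, ?_⟩
      · intro y hy
        by_cases hyx : y = x
        · subst hyx; simpa using hi
        · simpa [hyx] using hc y (mem_erase.mpr ⟨hyx, hy⟩)
      · intro y hy z hz hyz
        by_cases hyx : y = x
        · subst hyx
          have hzy : z ≠ y := hyz.ne'
          simpa [hzy] using fun e => hni z hz hyz e.symm
        · by_cases hzx : z = x
          · subst hzx
            simpa [hyx] using hni y hy hyz.symm
          · simpa [hyx, hzx] using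
              hp y (mem_erase.mpr ⟨hyx, hy⟩) z (mem_erase.mpr ⟨hzx, hz⟩) hyz
  obtain ⟨c, hc, hp⟩ := key _ univ rfl
  exact ⟨SimpleGraph.Coloring.mk (fun v => (⟨c v, hc v (mem_univ v)⟩ : Fin m))
    fun {v w} hvw e => hp v (mem_univ v) w (mem_univ w) hvw (congrArg Fin.val e)⟩

lemma exists_le_card_edgeFinset_eq {V : Type*} [Fintype V] (H : SimpleGraph V) {m : ℕ}
    (h : m ≤ #H.edgeFinset) : ∃ H' : SimpleGraph V, H' ≤ H ∧ #H'.edgeFinset = m := by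
  obtain ⟨T, hT, hc⟩ := exists_subset_card_eq h
  have hT' : (T : Set (Sym2 V)) ⊆ H.edgeSet := by
    intro e he
    exact SimpleGraph.mem_edgeFinset.mp (hT he)
  obtain ⟨H', he⟩ : ∃ H' : SimpleGraph V, H'.edgeSet = T := by
    refine ⟨SimpleGraph.fromEdgeSet T, ?_⟩
    rw [SimpleGraph.edgeSet_fromEdgeSet]
    ext e
    simp only [Set.mem_sdiff, and_iff_left_iff_imp]
    intro he hd
    exact H.not_isDiag_of_mem_edgeSet (hT' he) hd
  refine ⟨H', ?_, ?_⟩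
  · rw [← SimpleGraph.edgeSet_subset_edgeSet, he]
    exact hT'
  · rw [← hc]
    congr 1
    ext e
    rw [SimpleGraph.mem_edgeFinset, he, mem_coe]

lemma card_edgeFinset_le_add_degree {V : Type*} [Fintype V] (H : SimpleGraph V) (v : V) :
    #H.edgeFinset ≤ #{e ∈ H.edgeFinset | v ∉ e} + H.degree v := by
  rw [← H.card_incidenceFinset_eq_degree v, H.incidenceFinset_eq_filter v, add_comm]
  exact (card_filter_add_card_filter_not (s := H.edgeFinset) (fun e => v ∈ e)).ge

/-- The graph obtained from `H` by contracting the edge `uv` onto `u`, keeping `v` as an isolated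
vertex. -/
def contractTo {V : Type*} (H : SimpleGraph V) (u v : V) : SimpleGraph V where
  Adj a b := a ≠ b ∧ a ≠ v ∧ b ≠ v ∧
    (H.Adj a b ∨ (a = u ∧ H.Adj v b) ∨ (b = u ∧ H.Adj v a))
  symm := ⟨fun a b h => ⟨h.1.symm, h.2.2.1, h.2.1, by
    rcases h.2.2.2 with h | h | h
    · exact Or.inl h.symm
    · exact Or.inr (Or.inr h)
    · exact Or.inr (Or.inl h)⟩⟩
  loopless := ⟨fun a h => h.1 rfl⟩

lemma card_edgeFinset_le_contractTo {V : Type*} [Fintype V] (H : SimpleGraph V) {u v : V}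
    (huv : H.Adj v u) : #H.edgeFinset ≤
      #(contractTo H u v).edgeFinset + 1 + #{x ∈ H.neighborFinset v | H.Adj u x} := by
  set P : Finset V := {x ∈ H.neighborFinset v | x ≠ u ∧ ¬ H.Adj u x} with hP
  have h1 : #{e ∈ H.edgeFinset | v ∉ e} + #P ≤ #(contractTo H u v).edgeFinset := by
    have hinj : #(P.image fun x => s(u, x)) = #P := by
      apply card_image_of_injective
      intro x y hxy
      exact Sym2.congr_right.mp hxy
    rw [← hinj, ← card_union_of_disjoint]
    · apply card_le_card
      intro e he
      rw [mem_union] at he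
      rcases he with he | he
      · induction e with | h a b =>
        simp only [mem_filter, SimpleGraph.mem_edgeFinset, SimpleGraph.mem_edgeSet,
          Sym2.mem_iff, not_or] at he
        rw [SimpleGraph.mem_edgeFinset, SimpleGraph.mem_edgeSet]
        exact ⟨he.1.ne, Ne.symm he.2.1, Ne.symm he.2.2, Or.inl he.1⟩
      · obtain ⟨x, hx, rfl⟩ := mem_image.mp he
        simp only [hP, mem_filter, SimpleGraph.mem_neighborFinset] at hx
        rw [SimpleGraph.mem_edgeFinset, SimpleGraph.mem_edgeSet]
        exact ⟨hx.2.1.symm, huv.ne', hx.1.ne', Or.inr (Or.inl ⟨rfl, hx.1⟩)⟩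
    · rw [Finset.disjoint_left]
      intro e he he'
      obtain ⟨x, hx, rfl⟩ := mem_image.mp he'
      simp only [hP, mem_filter] at hx
      simp only [mem_filter, SimpleGraph.mem_edgeFinset, SimpleGraph.mem_edgeSet] at he
      exact hx.2.2 he.1
  have h2 : H.degree v ≤ #P + 1 + #{x ∈ H.neighborFinset v | H.Adj u x} := by
    rw [← SimpleGraph.card_neighborFinset_eq_degree]
    have hsub : H.neighborFinset v ⊆ (P ∪ {u}) ∪ {x ∈ H.neighborFinset v | H.Adj u x} := by
      intro x hx
      simp only [hP, mem_union, mem_filter, mem_singleton]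
      tauto
    refine (card_le_card hsub).trans ((card_union_le _ _).trans ?_)
    have := card_union_le P {u}
    rw [card_singleton] at this
    omega
  have h3 := card_edgeFinset_le_add_degree H v
  omega

lemma IsModelOn.mono {W V : Type*} {H H' : SimpleGraph W} {G : SimpleGraph V} {S S' : Finset W}
    {f : W → Set V} (h : IsModelOn H G S f) (hS : S' ⊆ S) (hH : H' ≤ H) : IsModelOn H' G S' f :=
  ⟨fun v hv => h.connected v (hS hv), fun v hv w hw => h.disjoint v (hS hv) w (hS hw),
    fun v hv w hw hvw => h.adj v (hS hv) w (hS hw) (hH hvw)⟩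

lemma IsModelOn.contractTo {W V : Type*} {H : SimpleGraph W} {G : SimpleGraph V} {S : Finset W}
    {f : W → Set V} (h : IsModelOn H G S f) {u v : W} (hu : u ∈ S) (hv : v ∈ S)
    (huv : H.Adj v u) :
    IsModelOn (contractTo H u v) G (S.erase v) (Function.update f u (f u ∪ f v)) := by
  have hsub : ∀ w, f w ⊆ Function.update f u (f u ∪ f v) w := by
    intro w
    by_cases hw : w = u
    · subst hw; simp
    · simp [hw]
  refine ⟨?_, ?_, ?_⟩
  · intro w hw
    rw [mem_erase] at hw
    by_cases hwu : w = u
    · subst hwu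
      obtain ⟨a, ha, b, hb, hab⟩ := h.adj v hv w hu huv
      rw [Function.update_self]
      exact SimpleGraph.connected_induce_union (h.connected w hu).preconnected
        (h.connected v hv).preconnected hb ha hab.symm
    · rw [Function.update_of_ne hwu]
      exact h.connected w hw.2
  · have key : ∀ w ∈ S, w ≠ v → w ≠ u → Disjoint (f u ∪ f v) (f w) := fun w hw hwv hwu =>
      Set.disjoint_union_left.mpr
        ⟨h.disjoint u hu w hw (Ne.symm hwu), h.disjoint v hv w hw (Ne.symm hwv)⟩
    intro w hw x hx hwx
    rw [mem_erase] at hw hx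
    by_cases hwu : w = u
    · subst hwu
      rw [Function.update_self, Function.update_of_ne hwx.symm]
      exact key x hx.2 hx.1 hwx.symm
    · rw [Function.update_of_ne hwu]
      by_cases hxu : x = u
      · subst hxu
        rw [Function.update_self]
        exact (key w hw.2 hw.1 hwx).symm
      · rw [Function.update_of_ne hxu]
        exact h.disjoint w hw.2 x hx.2 hwx
  · intro w hw x hx hwx
    rw [mem_erase] at hw hx
    rcases hwx.2.2.2 with hwx | ⟨rfl, hvx⟩ | ⟨rfl, hvw⟩
    · obtain ⟨a, ha, b, hb, hab⟩ := h.adj w hw.2 x hx.2 hwx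
      exact ⟨a, hsub w ha, b, hsub x hb, hab⟩
    · obtain ⟨a, ha, b, hb, hab⟩ := h.adj v hv x hx.2 hvx
      exact ⟨a, by simp [ha], b, hsub x hb, hab⟩
    · obtain ⟨a, ha, b, hb, hab⟩ := h.adj v hv w hw.2 hvw
      exact ⟨b, hsub w hb, a, by simp [ha], hab.symm⟩

/-- A graph with a subgraph of minimum degree at least `2 * d` has a minor on at most `2 * d` vertices
with minimum degree at least `d`. -/
lemma exists_dense_model {V : Type*} [Fintype V] (G : SimpleGraph V) {d : ℕ} (hd : 0 < d)
    {S₀ : Finset V} (hS₀ : S₀.Nonempty)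
    (hdeg : ∀ x ∈ S₀, 2 * d ≤ #{y ∈ S₀ | G.Adj x y}) :
    ∃ (H : SimpleGraph V) (f : V → Set V) (N : Finset V), IsModelOn H G N f ∧ N.Nonempty ∧
      #N ≤ 2 * d ∧ ∀ x ∈ N, d ≤ #{y ∈ N | H.Adj x y} := by
  let Q : ℕ → Prop := fun m => ∃ (H : SimpleGraph V) (f : V → Set V) (S : Finset V),
    IsModelOn H G S f ∧ 0 < m ∧ #S = m ∧ (∀ a b, H.Adj a b → a ∈ S) ∧ d * m ≤ #H.edgeFinset
  have hQ : ∃ m, Q m := by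
    obtain ⟨H, hH⟩ : ∃ H : SimpleGraph V, ∀ a b, H.Adj a b ↔ G.Adj a b ∧ a ∈ S₀ ∧ b ∈ S₀ :=
      ⟨{ Adj := fun a b => G.Adj a b ∧ a ∈ S₀ ∧ b ∈ S₀
         symm := ⟨fun a b h => ⟨h.1.symm, h.2.2, h.2.1⟩⟩
         loopless := ⟨fun a h => h.1.ne rfl⟩ }, fun a b => Iff.rfl⟩
    refine ⟨#S₀, H, fun v => {v}, S₀, ⟨?_, ?_, ?_⟩, hS₀.card_pos, rfl,
      fun a b h => ((hH a b).mp h).2.1, ?_⟩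
    · intro v _
      exact SimpleGraph.Connected.mk (SimpleGraph.Preconnected.of_subsingleton)
    · intro v _ w _ hvw
      simpa using hvw
    · intro v _ w _ hvw
      exact ⟨v, rfl, w, rfl, ((hH v w).mp hvw).1⟩
    · have h1 := H.sum_degrees_eq_twice_card_edges
      have h2 : ∑ v ∈ S₀, 2 * d ≤ ∑ v ∈ S₀, H.degree v := by
        apply sum_le_sum
        intro x hx
        refine (hdeg x hx).trans ?_
        rw [← SimpleGraph.card_neighborFinset_eq_degree]
        apply card_le_card
        intro y hy
        rw [mem_filter] at hy
        rw [SimpleGraph.mem_neighborFinset, hH]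
        exact ⟨hy.2, hx, hy.1⟩
      have h3 : ∑ v ∈ S₀, H.degree v ≤ ∑ v, H.degree v := sum_le_univ_sum_of_nonneg (by simp)
      rw [sum_const, smul_eq_mul] at h2
      nlinarith
  obtain ⟨H₀, f, S, hmod₀, hpos, hcard, hsupp₀, hle⟩ := Nat.find_spec hQ
  set m := Nat.find hQ with hm
  have hmin : ∀ k < m, ¬ Q k := fun k hk => Nat.find_min hQ hk
  obtain ⟨H, hH, hE⟩ := exists_le_card_edgeFinset_eq H₀ hle
  have hmod : IsModelOn H G S f := hmod₀.mono subset_rfl hH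
  have hsupp : ∀ a b, H.Adj a b → a ∈ S := fun a b h => hsupp₀ a b (hH h)
  have hSne : S.Nonempty := card_pos.mp (by omega)
  obtain ⟨v, hv, hvdeg⟩ : ∃ v ∈ S, H.degree v ≤ 2 * d := by
    apply exists_le_of_sum_le hSne
    have h1 := H.sum_degrees_eq_twice_card_edges
    have h3 : ∑ v ∈ S, H.degree v ≤ ∑ v, H.degree v := sum_le_univ_sum_of_nonneg (by simp)
    rw [sum_const, smul_eq_mul, hcard]
    rw [h1, hE] at h3
    linarith
  have hmul : d * (m - 1) + d = d * m := by
    rw [← Nat.mul_succ, Nat.succ_eq_add_one, Nat.sub_add_cancel hpos]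
  refine ⟨H, f, H.neighborFinset v, hmod.mono ?_ le_rfl, ?_, by simpa using hvdeg, ?_⟩
  · intro x hx
    rw [SimpleGraph.mem_neighborFinset] at hx
    exact hsupp x v hx.symm
  · by_contra hne
    rw [not_nonempty_iff_eq_empty] at hne
    have hnadj : ∀ x, ¬ H.Adj v x := by
      intro x hx
      rw [← SimpleGraph.mem_neighborFinset, hne] at hx
      simp at hx
    have hsupp' : ∀ a b, H.Adj a b → a ∈ S.erase v := by
      intro a b hab
      refine mem_erase.mpr ⟨?_, hsupp a b hab⟩
      rintro rfl
      exact hnadj b hab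
    have hEpos : 0 < #H.edgeFinset := by rw [hE]; positivity
    obtain ⟨e, he⟩ := card_pos.mp hEpos
    have hne' : (S.erase v).Nonempty := by
      induction e with | h a b =>
      rw [SimpleGraph.mem_edgeFinset, SimpleGraph.mem_edgeSet] at he
      exact ⟨a, hsupp' a b he⟩
    have hc : #(S.erase v) = m - 1 := by rw [card_erase_of_mem hv, hcard]
    have := hne'.card_pos
    exact hmin (m - 1) (by omega)
      ⟨H, f, S.erase v, hmod.mono (erase_subset _ _) le_rfl, by omega, hc, hsupp', by omega⟩
  · intro u hu
    rw [SimpleGraph.mem_neighborFinset] at hu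
    have huS := hsupp u v hu.symm
    have hc : #(S.erase v) = m - 1 := by rw [card_erase_of_mem hv, hcard]
    have hpos' : 0 < #(S.erase v) := card_pos.mpr ⟨u, mem_erase.mpr ⟨hu.ne', huS⟩⟩
    have hlt : #(contractTo H u v).edgeFinset < d * (m - 1) := by
      by_contra hcon
      refine hmin (m - 1) (by omega) ⟨contractTo H u v, _, S.erase v,
        hmod.contractTo huS hv hu, by omega, hc, ?_, by omega⟩
      intro a b hab
      refine mem_erase.mpr ⟨hab.2.1, ?_⟩
      rcases hab.2.2.2 with h | ⟨rfl, h⟩ | ⟨rfl, h⟩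
      · exact hsupp a b h
      · exact huS
      · exact hsupp a v h.symm
    have := card_edgeFinset_le_contractTo H hu
    omega

lemma dist_le_five {V : Type*} [Fintype V] (K : SimpleGraph V) {x y : V} {δ : ℕ}
    (hxy : K.Reachable x y) (hdeg : ∀ z, K.Reachable x z → δ ≤ K.degree z)
    (hcard : #{z | K.Reachable x z} < 3 * (δ + 1)) : K.dist x y ≤ 5 := by
  by_contra hd
  obtain ⟨w, hw⟩ := hxy.exists_walk_length_eq_dist
  have hp1 : (w.take 3).length ≤ 3 := by rw [SimpleGraph.Walk.take_length]; omega
  have hp2 : (w.drop 3).length = K.dist x y - 3 := by rw [SimpleGraph.Walk.drop_length, hw]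
  set p := w.getVert 3 with hp
  have hxp : K.Reachable x p := ⟨w.take 3⟩
  set B : V → Finset V := fun z => insert z (K.neighborFinset z) with hB
  have hBcard : ∀ z, K.Reachable x z → δ + 1 ≤ #(B z) := by
    intro z hz
    rw [hB, card_insert_of_notMem (by simp), SimpleGraph.card_neighborFinset_eq_degree]
    exact Nat.succ_le_succ (hdeg z hz)
  have hwalk : ∀ z, ∀ v ∈ B z, ∃ q : K.Walk z v, q.length ≤ 1 := by
    intro z v hv
    simp only [hB, mem_insert, SimpleGraph.mem_neighborFinset] at hv
    rcases hv with rfl | hv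
    · exact ⟨SimpleGraph.Walk.nil, by simp⟩
    · exact ⟨hv.toWalk, by simp⟩
  have hBsub : ∀ z, K.Reachable x z → B z ⊆ ({z | K.Reachable x z} : Finset V) := by
    intro z hz v hv
    obtain ⟨q, -⟩ := hwalk z v hv
    simpa using hz.trans ⟨q⟩
  have hshort : ∀ a b v, v ∈ B a → v ∈ B b → ∃ q : K.Walk a b, q.length ≤ 2 := by
    intro a b v ha hb
    obtain ⟨q, hq⟩ := hwalk a v ha
    obtain ⟨r, hr⟩ := hwalk b v hb
    exact ⟨q.append r.reverse, by
      rw [SimpleGraph.Walk.length_append, SimpleGraph.Walk.length_reverse]; omega⟩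
  have hd1 : Disjoint (B x) (B p) := by
    rw [Finset.disjoint_left]
    intro v h1 h2
    obtain ⟨q, hq⟩ := hshort x p v h1 h2
    have := SimpleGraph.dist_le (q.append (w.drop 3))
    rw [SimpleGraph.Walk.length_append] at this
    omega
  have hd2 : Disjoint (B x) (B y) := by
    rw [Finset.disjoint_left]
    intro v h1 h2
    obtain ⟨q, hq⟩ := hshort x y v h1 h2
    have := SimpleGraph.dist_le q
    omega
  have hd3 : Disjoint (B p) (B y) := by
    rw [Finset.disjoint_left]
    intro v h1 h2
    obtain ⟨q, hq⟩ := hshort p y v h1 h2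
    have := SimpleGraph.dist_le ((w.take 3).append q)
    rw [SimpleGraph.Walk.length_append] at this
    omega
  have hle : #((B x ∪ B p) ∪ B y) ≤ #{z | K.Reachable x z} := by
    apply card_le_card
    exact union_subset (union_subset (hBsub x (SimpleGraph.Reachable.refl x)) (hBsub p hxp))
      (hBsub y hxy)
  rw [card_union_of_disjoint (disjoint_union_left.mpr ⟨hd2, hd3⟩),
    card_union_of_disjoint hd1] at hle
  have := hBcard x (SimpleGraph.Reachable.refl x)
  have := hBcard p hxp
  have := hBcard y hxy
  omega

/-- A component of a graph with large minimum degree, in which any two vertices lie in a common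
connected set of at most six vertices. -/
lemma exists_component {V : Type*} [Fintype V] (H : SimpleGraph V) {U : Finset V} {δ : ℕ}
    (hU : U.Nonempty) (hdeg : ∀ x ∈ U, δ ≤ #{y ∈ U | H.Adj x y}) (hcard : #U < 3 * (δ + 1)) :
    ∃ C ⊆ U, C.Nonempty ∧ (∀ x ∈ C, ∀ y ∈ U, H.Adj x y → y ∈ C) ∧
      ∀ x ∈ C, ∀ y ∈ C, ∃ P ⊆ C, #P ≤ 6 ∧ x ∈ P ∧ y ∈ P ∧
        (H.induce (P : Set V)).Connected := by
  obtain ⟨K, hK⟩ : ∃ K : SimpleGraph V, ∀ a b, K.Adj a b ↔ H.Adj a b ∧ a ∈ U ∧ b ∈ U :=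
    ⟨{ Adj := fun a b => H.Adj a b ∧ a ∈ U ∧ b ∈ U
       symm := ⟨fun a b h => ⟨h.1.symm, h.2.2, h.2.1⟩⟩
       loopless := ⟨fun a h => h.1.ne rfl⟩ }, fun a b => Iff.rfl⟩
  have hKH : K ≤ H := fun a b h => ((hK a b).mp h).1
  have hreach : ∀ x ∈ U, ∀ y, K.Reachable x y → y ∈ U := by
    rintro x hx y ⟨w⟩
    induction w with
    | nil => exact hx
    | cons h _ ih => exact ih ((hK _ _).mp h).2.2
  obtain ⟨x₀, hx₀⟩ := hU
  have hmem : ∀ y, y ∈ ({y | K.Reachable x₀ y} : Finset V) ↔ K.Reachable x₀ y := by simp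
  refine ⟨({y | K.Reachable x₀ y} : Finset V), ?_, ⟨x₀, by simp⟩, ?_, ?_⟩
  · intro y hy
    exact hreach x₀ hx₀ y ((hmem y).mp hy)
  · intro x hx y hy hxy
    rw [hmem] at hx ⊢
    exact hx.trans (SimpleGraph.Adj.reachable ((hK x y).mpr ⟨hxy, hreach x₀ hx₀ x hx, hy⟩))
  · intro x hx y hy
    rw [hmem] at hx hy
    have hxy : K.Reachable x y := hx.symm.trans hy
    have hxU := hreach x₀ hx₀ x hx
    have hdist : K.dist x y ≤ 5 := by
      refine dist_le_five K (δ := δ) hxy ?_ ?_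
      · intro z hz
        have hzU := hreach x hxU z hz
        refine (hdeg z hzU).trans ?_
        rw [← SimpleGraph.card_neighborFinset_eq_degree]
        apply card_le_card
        intro v hv
        rw [mem_filter] at hv
        rw [SimpleGraph.mem_neighborFinset, hK]
        exact ⟨hv.2, hzU, hv.1⟩
      · refine (card_le_card ?_).trans_lt hcard
        intro z hz
        exact hreach x hxU z (by simpa using hz)
    obtain ⟨w, hw⟩ := hxy.exists_walk_length_eq_dist
    refine ⟨w.support.toFinset, ?_, ?_, by simp, by simp, ?_⟩
    · intro z hz
      rw [List.mem_toFinset] at hz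
      rw [hmem]
      exact hx.trans ⟨w.takeUntil z hz⟩
    · refine (List.toFinset_card_le _).trans ?_
      rw [SimpleGraph.Walk.length_support]
      omega
    · have h := (w.mapLe hKH).connected_induce_support
      rw [SimpleGraph.Walk.support_mapLe_eq_support] at h
      rwa [List.coe_toFinset]

/-- A random sequence of `s` vertices dominates almost everything and escapes all the given
sets. -/
lemma exists_dominating_sequence {V : Type*} (H : SimpleGraph V) {C : Finset V}
    {e s t : ℕ} (he : 0 < e) (hC1 : 2 * e ≤ #C) (hC2 : #C ≤ 6 * e)
    (hdeg : ∀ x ∈ C, 2 * e ≤ #{y ∈ C | H.Adj x y}) (A : ℕ → Finset V)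
    (hA : ∀ j < t, (#(C ∩ A j) : ℝ) ≤ 12 * e * (2 / 3) ^ s)
    (hs : 2 * t * (6 : ℝ) ^ s < (3 / 2) ^ (s * s)) :
    ∃ g : Fin s → V, (∀ i, g i ∈ C) ∧
      (#{x ∈ C | ∀ i, ¬ H.Adj x (g i)} : ℝ) ≤ 12 * e * (2 / 3) ^ s ∧
      ∀ j < t, ∃ i, g i ∉ A j := by
  by_contra! hcon
  set a : ℝ := 12 * e * (2 / 3) ^ s with ha
  have heR : (0 : ℝ) < e := by exact_mod_cast he
  have ha0 : 0 < a := by positivity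
  set Ω : Finset (Fin s → V) := Fintype.piFinset fun _ => C with hΩ
  have hΩcard : #Ω = #C ^ s := Fintype.card_piFinset_const C s
  have hall : ∀ (p : V → Prop) [DecidablePred p]
      [DecidablePred fun g : Fin s → V => ∀ i, p (g i)],
      #{g ∈ Ω | ∀ i, p (g i)} = #{y ∈ C | p y} ^ s := by
    intro p _ _
    rw [← Fintype.card_piFinset_const]
    congr 1
    ext g
    simp only [hΩ, mem_filter, Fintype.mem_piFinset]
    exact forall_and.symm
  have hpoint : ∀ g ∈ Ω, (1 : ℝ) ≤ (#{x ∈ C | ∀ i, ¬ H.Adj x (g i)} : ℝ) / a +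
      ∑ j ∈ range t, if ∀ i, g i ∈ A j then (1 : ℝ) else 0 := by
    intro g hg
    have hnn : (0 : ℝ) ≤ ∑ j ∈ range t, if ∀ i, g i ∈ A j then (1 : ℝ) else 0 :=
      sum_nonneg fun j _ => by split_ifs <;> norm_num
    by_cases hund : (#{x ∈ C | ∀ i, ¬ H.Adj x (g i)} : ℝ) ≤ a
    · obtain ⟨j, hj, hjA⟩ := hcon g (by simpa [hΩ] using hg) hund
      have h1 := single_le_sum (f := fun j => if ∀ i, g i ∈ A j then (1 : ℝ) else 0)
        (fun j _ => by split_ifs <;> norm_num) (mem_range.mpr hj)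
      simp only [if_pos hjA] at h1
      have h2 : (0 : ℝ) ≤ (#{x ∈ C | ∀ i, ¬ H.Adj x (g i)} : ℝ) / a := by positivity
      linarith
    · push Not at hund
      have : (1 : ℝ) ≤ (#{x ∈ C | ∀ i, ¬ H.Adj x (g i)} : ℝ) / a := by
        rw [le_div_iff₀ ha0]; linarith
      linarith
  have hsum := sum_le_sum hpoint
  rw [sum_const, nsmul_eq_mul, mul_one, hΩcard, sum_add_distrib, ← sum_div, sum_comm] at hsum
  have hfirst : (∑ g ∈ Ω, (#{x ∈ C | ∀ i, ¬ H.Adj x (g i)} : ℝ)) ≤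
      #C * (2 / 3 * #C : ℝ) ^ s := by
    have h1 : (∑ g ∈ Ω, #{x ∈ C | ∀ i, ¬ H.Adj x (g i)}) =
        ∑ x ∈ C, #{y ∈ C | ¬ H.Adj x y} ^ s := by
      have := sum_card_bipartiteAbove_eq_sum_card_bipartiteBelow (s := Ω) (t := C)
        (fun g x => ∀ i, ¬ H.Adj x (g i))
      simp only [bipartiteAbove, bipartiteBelow] at this
      rw [this]
      exact sum_congr rfl fun x _ => hall fun y => ¬ H.Adj x y
    have h2 : (∑ g ∈ Ω, (#{x ∈ C | ∀ i, ¬ H.Adj x (g i)} : ℝ)) =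
        ∑ x ∈ C, (#{y ∈ C | ¬ H.Adj x y} : ℝ) ^ s := by exact_mod_cast h1
    rw [h2, ← nsmul_eq_mul]
    apply sum_le_card_nsmul
    intro x hx
    have h3 := card_filter_add_card_filter_not (s := C) (fun y => H.Adj x y)
    have h4 := hdeg x hx
    have h5 : 3 * #{y ∈ C | ¬ H.Adj x y} ≤ 2 * #C := by omega
    have h6 : (3 : ℝ) * #{y ∈ C | ¬ H.Adj x y} ≤ 2 * #C := by exact_mod_cast h5
    gcongr
    linarith
  have hsecond : (∑ j ∈ range t, ∑ g ∈ Ω, if ∀ i, g i ∈ A j then (1 : ℝ) else 0) ≤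
      t * a ^ s := by
    refine (sum_le_card_nsmul _ _ (a ^ s) fun j hj => ?_).trans_eq
      (by rw [card_range, nsmul_eq_mul])
    rw [sum_boole, hall fun y => y ∈ A j, filter_mem_eq_inter, Nat.cast_pow]
    exact pow_le_pow_left₀ (by positivity) (hA j (mem_range.mp hj)) s
  have hC1' : (2 : ℝ) * e ≤ #C := by exact_mod_cast hC1
  have hC2' : (#C : ℝ) ≤ 6 * e := by exact_mod_cast hC2
  have hcpos : (0 : ℝ) < (#C : ℝ) ^ s := by
    have : (0 : ℝ) < #C := by linarith
    positivity
  have hfirst' : (∑ g ∈ Ω, (#{x ∈ C | ∀ i, ¬ H.Adj x (g i)} : ℝ)) / a ≤ (#C : ℝ) ^ s / 2 := by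
    rw [div_le_iff₀ ha0]
    refine hfirst.trans ?_
    rw [mul_pow, ha]
    have : (#C : ℝ) * ((2 / 3) ^ s * (#C : ℝ) ^ s) ≤ 6 * e * ((2 / 3) ^ s * (#C : ℝ) ^ s) := by
      gcongr
    linarith
  have hsecond' : (t : ℝ) * a ^ s < (#C : ℝ) ^ s / 2 := by
    have h1 : a ≤ 6 * (2 / 3) ^ s * #C := by
      rw [ha]
      have : (0 : ℝ) ≤ (2 / 3) ^ s := by positivity
      nlinarith
    have h2 : a ^ s ≤ (6 * (2 / 3) ^ s * #C) ^ s := pow_le_pow_left₀ ha0.le h1 s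
    have h3 : (6 * (2 / 3) ^ s * #C : ℝ) ^ s = 6 ^ s * (2 / 3) ^ (s * s) * (#C : ℝ) ^ s := by
      rw [mul_pow, mul_pow, ← pow_mul]
    have h4 : (2 / 3 : ℝ) ^ (s * s) * (3 / 2) ^ (s * s) = 1 := by
      rw [← mul_pow]; norm_num
    have h5 : 2 * t * (6 : ℝ) ^ s * (2 / 3) ^ (s * s) < 1 := by
      rw [← h4, mul_comm ((2 / 3 : ℝ) ^ (s * s))]
      gcongr
    have h6 : (t : ℝ) * a ^ s ≤ t * (6 ^ s * (2 / 3) ^ (s * s) * (#C : ℝ) ^ s) := by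
      rw [← h3]; gcongr
    nlinarith
  push_cast at hsum
  linarith

lemma exists_dominating_connected {V : Type*} [Fintype V] (H : SimpleGraph V) {U : Finset V}
    {e s t : ℕ} (he : 0 < e) (hs₀ : 0 < s) (hU : U.Nonempty) (hUcard : #U ≤ 6 * e)
    (hdeg : ∀ x ∈ U, 2 * e ≤ #{y ∈ U | H.Adj x y}) (A : ℕ → Finset V)
    (hA : ∀ j < t, (#(U ∩ A j) : ℝ) ≤ 12 * e * (2 / 3) ^ s)
    (hs : 2 * t * (6 : ℝ) ^ s < (3 / 2) ^ (s * s)) :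
    ∃ C ⊆ U, 2 * e ≤ #C ∧ (∀ x ∈ C, ∀ y ∈ U, H.Adj x y → y ∈ C) ∧
      ∃ B ⊆ C, #B ≤ 6 * s ∧ (H.induce (B : Set V)).Connected ∧
        (#{x ∈ C | ∀ b ∈ B, ¬ H.Adj x b} : ℝ) ≤ 12 * e * (2 / 3) ^ s ∧
        ∀ j < t, ∃ b ∈ B, b ∉ A j := by
  obtain ⟨C, hCU, ⟨x₀, hx₀⟩, hclosed, hP⟩ :=
    exists_component H (δ := 2 * e) hU hdeg (by omega)
  have hdegC : ∀ x ∈ C, 2 * e ≤ #{y ∈ C | H.Adj x y} := by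
    intro x hx
    refine (hdeg x (hCU hx)).trans (card_le_card ?_)
    intro y hy
    rw [mem_filter] at hy ⊢
    exact ⟨hclosed x hx y hy.1 hy.2, hy.2⟩
  have hC1 : 2 * e ≤ #C := (hdegC x₀ hx₀).trans (card_filter_le _ _)
  obtain ⟨g, hgC, hdom, hesc⟩ := exists_dominating_sequence H he hC1
    ((card_le_card hCU).trans hUcard) hdegC A
    (fun j hj => le_trans (by gcongr) (hA j hj)) hs
  have hP' : ∀ i, ∃ P ⊆ C, #P ≤ 6 ∧ g ⟨0, hs₀⟩ ∈ P ∧ g i ∈ P ∧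
      (H.induce (P : Set V)).Connected := fun i => hP _ (hgC _) _ (hgC i)
  choose P hPC hPcard hP0 hPi hPconn using hP'
  have hgB : ∀ i, g i ∈ univ.biUnion P := fun i => mem_biUnion.mpr ⟨i, mem_univ i, hPi i⟩
  refine ⟨C, hCU, hC1, hclosed, univ.biUnion P, biUnion_subset.mpr fun i _ => hPC i, ?_, ?_, ?_, ?_⟩
  · refine (card_biUnion_le_card_mul univ P 6 fun i _ => hPcard i).trans ?_
    rw [card_univ, Fintype.card_fin, mul_comm]
  · apply H.induce_connected_of_patches (g ⟨0, hs₀⟩) (hgB _)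
    intro v hv
    rw [mem_coe, mem_biUnion] at hv
    obtain ⟨i, -, hi⟩ := hv
    refine ⟨P i, ?_, hP0 i, hi, (hPconn i).preconnected _ _⟩
    exact_mod_cast subset_biUnion_of_mem P (mem_univ i)
  · refine le_trans ?_ hdom
    exact_mod_cast card_le_card fun x hx => by
      rw [mem_filter] at hx ⊢
      exact ⟨hx.1, fun i => hx.2 _ (hgB i)⟩
  · intro j hj
    obtain ⟨i, hi⟩ := hesc j hj
    exact ⟨g i, hgB i, hi⟩

/-- In a dense graph there are many disjoint connected sets which are pairwise joined by an
edge. -/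
lemma exists_connected_family {V : Type*} [Fintype V] (H : SimpleGraph V) {N : Finset V}
    {e s t : ℕ} (he : 0 < e) (hs₀ : 0 < s) (hN : N.Nonempty) (hNcard : #N ≤ 6 * e)
    (hdeg : ∀ x ∈ N, 3 * e ≤ #{y ∈ N | H.Adj x y}) (hst : 6 * s * t ≤ e)
    (hs : 2 * t * (6 : ℝ) ^ s < (3 / 2) ^ (s * s)) :
    ∃ B : ℕ → Finset V, (∀ j < t, B j ⊆ N ∧ (H.induce (B j : Set V)).Connected) ∧
      ∀ j < t, ∀ k < j, Disjoint (B j) (B k) ∧ ∃ b ∈ B j, ∃ c ∈ B k, H.Adj b c := by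
  have key : ∀ i ≤ t, ∃ (U : Finset V) (B : ℕ → Finset V), U.Nonempty ∧ U ⊆ N ∧
      (∀ x ∈ U, 3 * e ≤ #{y ∈ U | H.Adj x y} + 6 * s * i) ∧
      (∀ j < i, B j ⊆ N ∧ (H.induce (B j : Set V)).Connected ∧ Disjoint (B j) U ∧
        (#{x ∈ U | ∀ b ∈ B j, ¬ H.Adj x b} : ℝ) ≤ 12 * e * (2 / 3) ^ s) ∧
      ∀ j < i, ∀ k < j, Disjoint (B j) (B k) ∧ ∃ b ∈ B j, ∃ c ∈ B k, H.Adj b c := by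
    intro i
    induction i with
    | zero =>
      exact fun _ => ⟨N, fun _ => ∅, hN, subset_rfl, by simpa using hdeg, by simp, by simp⟩
    | succ i ih =>
      intro hi
      obtain ⟨U, B, hU, hUN, hdegU, hB, hBB⟩ := ih (by omega)
      have hbud : 6 * s * (i + 1) ≤ e := (Nat.mul_le_mul_left _ hi).trans hst
      rw [Nat.mul_succ] at hbud
      obtain ⟨C, hCU, hC, hclosed, B', hB'C, hB'card, hconn, hdom, hesc⟩ :=
        exists_dominating_connected H (t := i) he hs₀ hU ((card_le_card hUN).trans hNcard)
          (fun x hx => by have := hdegU x hx; omega)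
          (fun j => {x ∈ U | ∀ b ∈ B j, ¬ H.Adj x b})
          (fun j hj => by
            rw [inter_eq_right.mpr (filter_subset _ _)]
            exact (hB j hj).2.2.2)
          (lt_of_le_of_lt (by gcongr; omega) hs)
      have hUsub : C \ B' ⊆ U := sdiff_subset.trans hCU
      obtain ⟨B₁, hB₁, hB₁'⟩ : ∃ B₁ : ℕ → Finset V, B₁ i = B' ∧ ∀ j ≠ i, B₁ j = B j :=
        ⟨fun j => if j = i then B' else B j, by simp, fun j hj => by simp [hj]⟩
      refine ⟨C \ B', B₁, ?_, hUsub.trans hUN, ?_, ?_, ?_⟩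
      · rw [← card_pos]
        have := le_card_sdiff B' C
        omega
      · intro x hx
        have hxC := (mem_sdiff.mp hx).1
        have hsub : ({y ∈ U | H.Adj x y} : Finset V) ⊆
            ({y ∈ C \ B' | H.Adj x y} : Finset V) ∪ B' := by
          intro y hy
          rw [mem_filter] at hy
          have := hclosed x hxC y hy.1 hy.2
          simp only [mem_union, mem_filter, mem_sdiff]
          tauto
        have h1 := (card_le_card hsub).trans (card_union_le _ _)
        have h2 := hdegU x (hCU hxC)
        rw [Nat.mul_succ]
        omega
      · intro j hj
        by_cases hji : j = i
        · rw [hji, hB₁]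
          refine ⟨hB'C.trans (hCU.trans hUN), hconn, disjoint_sdiff, le_trans ?_ hdom⟩
          exact_mod_cast card_le_card (filter_subset_filter _ sdiff_subset)
        · rw [hB₁' j hji]
          obtain ⟨h1, h2, h3, h4⟩ := hB j (by omega)
          refine ⟨h1, h2, disjoint_of_subset_right hUsub h3, le_trans ?_ h4⟩
          exact_mod_cast card_le_card (filter_subset_filter _ hUsub)
      · intro j hj k hk
        have hki : k ≠ i := by omega
        by_cases hji : j = i
        · subst hji
          rw [hB₁, hB₁' k hki]
          refine ⟨(disjoint_of_subset_right (hB'C.trans hCU) (hB k hk).2.2.1).symm, ?_⟩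
          obtain ⟨b, hb, hbA⟩ := hesc k hk
          have hbU := hCU (hB'C hb)
          simp only [mem_filter, hbU, true_and, not_forall, not_not] at hbA
          obtain ⟨c, hc, hbc⟩ := hbA
          exact ⟨b, hb, c, hc, hbc⟩
        · rw [hB₁' j hji, hB₁' k hki]
          exact hBB j (by omega) k hk
  obtain ⟨U, B, -, -, -, hB, hBB⟩ := key t le_rfl
  exact ⟨B, fun j hj => ⟨(hB j hj).1, (hB j hj).2.1⟩, hBB⟩

lemma IsModelOn.connected_biUnion {W V : Type*} {H : SimpleGraph W} {G : SimpleGraph V}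
    {S B : Finset W} {f : W → Set V} (h : IsModelOn H G S f) (hBS : B ⊆ S)
    (hB : (H.induce (B : Set W)).Connected) : (G.induce (⋃ x ∈ B, f x)).Connected := by
  have hsub : ∀ x ∈ B, f x ⊆ ⋃ x ∈ B, f x := fun x hx => Set.subset_biUnion_of_mem (u := f) hx
  have hin : ∀ x (hx : x ∈ B), ∀ a (ha : a ∈ f x) b (hb : b ∈ f x),
      (G.induce (⋃ x ∈ B, f x)).Reachable ⟨a, hsub x hx ha⟩ ⟨b, hsub x hx hb⟩ := by
    intro x hx a ha b hb
    exact ((h.connected x (hBS hx)).preconnected ⟨a, ha⟩ ⟨b, hb⟩).map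
      (G.induceHomOfLE (hsub x hx)).toHom
  have key : ∀ x y : (B : Set W), (H.induce (B : Set W)).Walk x y →
      ∀ a (ha : a ∈ f x) b (hb : b ∈ f y),
      (G.induce (⋃ x ∈ B, f x)).Reachable ⟨a, hsub x x.2 ha⟩ ⟨b, hsub y y.2 hb⟩ := by
    intro x y w
    induction w with
    | nil => exact fun a ha b hb => hin _ (Subtype.property _) a ha b hb
    | @cons x z y hxz _ ih =>
      intro a ha b hb
      obtain ⟨p, hp, q, hq, hpq⟩ := h.adj x (hBS x.2) z (hBS z.2) hxz
      have h1 := hin x x.2 a ha p hp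
      have h2 : (G.induce (⋃ x ∈ B, f x)).Adj ⟨p, hsub x x.2 hp⟩ ⟨q, hsub z z.2 hq⟩ := hpq
      exact h1.trans (h2.reachable.trans (ih q hq b hb))
  obtain ⟨x₀⟩ := hB.nonempty
  obtain ⟨a₀⟩ := (h.connected x₀ (hBS x₀.2)).nonempty
  have : Nonempty (⋃ x ∈ B, f x : Set V) := ⟨⟨a₀, hsub x₀ x₀.2 a₀.2⟩⟩
  refine SimpleGraph.Connected.mk ?_
  rintro ⟨a, ha⟩ ⟨b, hb⟩
  obtain ⟨x, hx, hax⟩ := Set.mem_iUnion₂.mp ha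
  obtain ⟨y, hy, hby⟩ := Set.mem_iUnion₂.mp hb
  obtain ⟨w⟩ := hB.preconnected ⟨x, hx⟩ ⟨y, hy⟩
  exact key _ _ w a hax b hby

lemma completeGraph_isMinorOf {V : Type*} [Fintype V] (G : SimpleGraph V) {e s t : ℕ}
    (he : 0 < e) (hs₀ : 0 < s) (hG : ¬ G.Colorable (6 * e)) (hst : 6 * s * t ≤ e)
    (hs : 2 * t * (6 : ℝ) ^ s < (3 / 2) ^ (s * s)) :
    (⊤ : SimpleGraph (Fin t)).IsMinorOf G := by
  obtain ⟨S₀, hS₀, hdeg₀⟩ : ∃ S : Finset V, S.Nonempty ∧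
      ∀ x ∈ S, 2 * (3 * e) ≤ #{y ∈ S | G.Adj x y} := by
    by_contra! hcon
    refine hG (colorable_of_forall_exists_lt G _ fun S hS => ?_)
    obtain ⟨x, hx, hlt⟩ := hcon S hS
    exact ⟨x, hx, by omega⟩
  obtain ⟨H, f, N, hmod, hN, hNcard, hdeg⟩ := exists_dense_model G (by omega) hS₀ hdeg₀
  obtain ⟨B, hB, hBB⟩ := exists_connected_family H he hs₀ hN (by omega) hdeg hst hs
  refine ⟨fun i => ⋃ x ∈ B i, f x, fun i => ?_, ?_, ?_⟩
  · exact hmod.connected_biUnion (hB i i.2).1 (hB i i.2).2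
  · have hlt : ∀ i j : Fin t, j < i → Disjoint (⋃ x ∈ B i, f x) (⋃ x ∈ B j, f x) := by
      intro i j hij
      have hd := (hBB i i.2 j hij).1
      simp only [Set.disjoint_iUnion_left, Set.disjoint_iUnion_right]
      intro x hx y hy
      refine hmod.disjoint _ ((hB j j.2).1 ?_) _ ((hB i i.2).1 ?_) ?_ |>.symm <;> first
        | assumption
        | (rintro rfl; exact Finset.disjoint_left.mp hd ‹_› ‹_›)
    intro i j hij
    rcases lt_or_gt_of_ne hij with h | h
    · exact (hlt j i h).symm
    · exact hlt i j h
  · have hlt : ∀ i j : Fin t, j < i →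
        ∃ u ∈ ⋃ x ∈ B i, f x, ∃ v ∈ ⋃ x ∈ B j, f x, G.Adj u v := by
      intro i j hij
      obtain ⟨b, hb, c, hc, hbc⟩ := (hBB i i.2 j hij).2
      obtain ⟨u, hu, v, hv, huv⟩ := hmod.adj b ((hB i i.2).1 hb) c ((hB j j.2).1 hc) hbc
      exact ⟨u, Set.mem_biUnion hb hu, v, Set.mem_biUnion hc hv, huv⟩
    intro i j hij
    rcases lt_or_gt_of_ne hij.ne with h | h
    · obtain ⟨u, hu, v, hv, huv⟩ := hlt j i h
      exact ⟨v, hv, u, hu, huv.symm⟩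
    · exact hlt i j h

lemma le_hadwigerNumber {V : Type*} [Fintype V] {G : SimpleGraph V} {n : ℕ}
    (h : (⊤ : SimpleGraph (Fin n)).IsMinorOf G) : n ≤ G.hadwigerNumber := by
  refine le_csSup ⟨Fintype.card V, ?_⟩ h
  rintro m ⟨f, hconn, hdisj, -⟩
  choose g hg using fun w => Set.nonempty_coe_sort.mp (hconn w).nonempty
  have hinj : Function.Injective g := by
    intro v w hvw
    by_contra hne
    exact Set.disjoint_left.mp (hdisj hne) (hg v) (hvw ▸ hg w)
  simpa using Fintype.card_le_of_injective g hinj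

lemma one_le_hadwigerNumber {V : Type*} [Fintype V] [Nonempty V] (G : SimpleGraph V) :
    1 ≤ G.hadwigerNumber := by
  refine le_hadwigerNumber ⟨fun _ => {Classical.arbitrary V}, fun _ => ?_, ?_, ?_⟩
  · exact SimpleGraph.Connected.mk SimpleGraph.Preconnected.of_subsingleton
  · intro i j hij
    exact absurd (Subsingleton.elim i j) hij
  · intro i j hij
    exact absurd (Subsingleton.elim i j) hij.ne

lemma mul_six_pow_lt {k x : ℝ} {s : ℕ} (hk : 0 ≤ k) (hx : x ^ 2 = Real.log k) (hx1 : 1 ≤ x)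
    (hxs : 10 * x ≤ s) : k * (6 : ℝ) ^ s < (3 / 2) ^ (s * s) := by
  have hk0 : 0 < k := by
    rcases hk.eq_or_lt with rfl | h
    · rw [Real.log_zero] at hx; nlinarith
    · exact h
  have h6 : (6 : ℝ) ≤ Real.exp 2 := by
    have h := Real.exp_one_gt_d9
    have : Real.exp 2 = Real.exp 1 * Real.exp 1 := by rw [← Real.exp_add]; norm_num
    nlinarith
  have h32 : Real.exp (1 / 3) ≤ 3 / 2 := by
    have h := Real.exp_one_lt_d9
    have h3 : Real.exp (1 / 3) ^ 3 = Real.exp 1 := by rw [← Real.exp_nat_mul]; norm_num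
    by_contra! hlt
    have : (3 / 2 : ℝ) ^ 3 < Real.exp (1 / 3) ^ 3 := by gcongr
    norm_num at this
    linarith
  calc k * (6 : ℝ) ^ s ≤ Real.exp (x ^ 2) * Real.exp 2 ^ s := by
        rw [hx, Real.exp_log hk0]; gcongr
    _ = Real.exp (x ^ 2 + s * 2) := by rw [Real.exp_add, ← Real.exp_nat_mul]
    _ < Real.exp ((s * s : ℕ) * (1 / 3)) := by
        apply Real.exp_lt_exp.mpr
        push_cast
        nlinarith
    _ = Real.exp (1 / 3) ^ (s * s) := Real.exp_nat_mul _ _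
    _ ≤ (3 / 2) ^ (s * s) := by gcongr

end

end HadwigerBound

theorem stmt_17 :
    ∃ c : ℝ, 0 < c ∧
      ∀ (V : Type) [Fintype V] (G : SimpleGraph V),
        2 ≤ G.chromaticNumber →
        c * (G.chromaticNumber.toNat : ℝ) / Real.sqrt (Real.log (G.chromaticNumber.toNat : ℝ)) ≤
          (G.hadwigerNumber : ℝ) := by
  refine ⟨1 / 2000, by norm_num, fun V _ G hχ => ?_⟩
  have hne : Nonempty V := by
    by_contra h
    rw [not_nonempty_iff] at h
    rw [SimpleGraph.chromaticNumber_eq_zero_of_isEmpty] at hχ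
    simp at hχ
  have htop : G.chromaticNumber ≠ ⊤ :=
    SimpleGraph.chromaticNumber_ne_top_iff_exists.mpr
      ⟨_, SimpleGraph.colorable_chromaticNumber_of_fintype G⟩
  obtain ⟨k, hk⟩ := ENat.ne_top_iff_exists.mp htop
  rw [← hk] at hχ ⊢
  rw [ENat.toNat_natCast]
  have hk2 : 2 ≤ k := by exact_mod_cast hχ
  have hη : (1 : ℝ) ≤ G.hadwigerNumber := by
    exact_mod_cast HadwigerBound.one_le_hadwigerNumber G
  set x := Real.sqrt (Real.log k) with hx
  have hlog2 : Real.log 2 ≤ Real.log k :=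
    Real.log_le_log (by norm_num) (by exact_mod_cast hk2)
  have hlog2' := Real.log_two_gt_d9
  have hxsq : x ^ 2 = Real.log k := Real.sq_sqrt (by linarith)
  have hx0 : 1 / 2 ≤ x := Real.le_sqrt_of_sq_le (by linarith)
  rw [div_le_iff₀ (by linarith)]
  rcases lt_or_ge k 7 with hk7 | hk7
  · have : (k : ℝ) ≤ 7 := by exact_mod_cast hk7.le
    nlinarith
  have hx1 : 1 ≤ x := by
    apply Real.le_sqrt_of_sq_le
    have h4 : Real.log 4 ≤ Real.log k :=
      Real.log_le_log (by norm_num) (by exact_mod_cast (by omega : 4 ≤ k))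
    have : Real.log 4 = 2 * Real.log 2 := by
      rw [show (4 : ℝ) = 2 ^ 2 by norm_num, Real.log_pow]; norm_num
    linarith
  set e := (k - 1) / 6 with he
  set s := ⌈10 * x⌉₊ with hs
  have hs1 : 10 * x ≤ s := Nat.le_ceil _
  have hs2 : (s : ℝ) < 10 * x + 1 := Nat.ceil_lt_add_one (by linarith)
  have hs0 : 0 < s := by
    have : (0 : ℝ) < s := by linarith
    exact_mod_cast this
  set t := e / (6 * s) with ht
  have hst : 6 * s * t ≤ e := Nat.mul_div_le _ _
  have hte : t ≤ e := Nat.div_le_self _ _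
  have hcol : ¬ G.Colorable (6 * e) := by
    intro h
    have := h.chromaticNumber_le
    rw [← hk] at this
    have : k ≤ 6 * e := by exact_mod_cast this
    omega
  have hminor := HadwigerBound.completeGraph_isMinorOf G (t := t) (by omega) hs0 hcol hst
    (lt_of_le_of_lt (by gcongr; exact_mod_cast (by omega : 2 * t ≤ k))
      (HadwigerBound.mul_six_pow_lt (Nat.cast_nonneg k) hxsq hx1 hs1))
  have htη : (t : ℝ) ≤ G.hadwigerNumber := by
    exact_mod_cast HadwigerBound.le_hadwigerNumber hminor
  have hlt : e < 6 * s * (t + 1) := Nat.lt_mul_div_succ _ (by omega)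
  have hlt' : (e : ℝ) < 6 * s * (t + 1) := by exact_mod_cast hlt
  have hke : (k : ℝ) ≤ 12 * e := by exact_mod_cast (by omega : k ≤ 12 * e)
  have h1 : (6 : ℝ) * s * (t + 1) ≤ 6 * (11 * x) * (2 * G.hadwigerNumber) := by
    gcongr <;> linarith
  linarith
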